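/- arXiv:1512.03272 — 2 statements merged into one kernel-verified Lean document; each statement's English description precedes it below -/
import Mathlib

section
/- Let Δ = inf{ δ ∈ ℝ : there exists C with J(X) ≤ C X^{6+δ} for all X ≥ 1 } (so Δ ∈ [0,6]). Then for every ε > 0, every integer n ≥ 0, and all positive integers a, b with 1 ≤ a ≤ b, there is a constant C(ε,n,a,b), independent of X and of the prime p ≥ 5, such that whenever p^{3^n b} ≤ X one has I_2(X;a,b) ≤ C(ε,n,a,b) · X^{6+Δ+ε} · p^{−2a−4b} · p^{(3 − nΔ/6)(3b−a)}. -/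
/-- `Jcount s k X` is the number of `2s`-tuples `(x₁,…,x_{2s})` of positive integers
with each `xᵢ ≤ X` satisfying `x₁ʲ+⋯+x_sʲ = x_{s+1}ʲ+⋯+x_{2s}ʲ` for all `1 ≤ j ≤ k`.
The tuple is encoded as a pair of `s`-tuples (the two sides of the system). -/
noncomputable def Jcount (s k : ℕ) (X : ℝ) : ℕ :=
  Nat.card {xy : (Fin s → ℕ) × (Fin s → ℕ) //
    (∀ i, 1 ≤ xy.1 i ∧ (xy.1 i : ℝ) ≤ X) ∧
    (∀ i, 1 ≤ xy.2 i ∧ (xy.2 i : ℝ) ≤ X) ∧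
    ∀ j ∈ Finset.Icc 1 k, ∑ i, xy.1 i ^ j = ∑ i, xy.2 i ^ j}

/-- `Icount p X m a b ξ η` is the number of 12-tuples `(x₁,…,x₆,x₇,…,x₁₂)` of positive
integers `≤ X` (encoded as a pair of 6-tuples) satisfying
`x₁ʲ+⋯+x₆ʲ = x₇ʲ+⋯+x₁₂ʲ` for `j = 1,2,3`, with `xᵢ ≡ ξ (mod pᵃ)` for
`1 ≤ i ≤ m` and `7 ≤ i ≤ 6+m`, and `xᵢ ≡ η (mod pᵇ)` for the remaining indices. -/
noncomputable def Icount (p : ℕ) (X : ℝ) (m a b : ℕ) (ξ η : ℤ) : ℕ :=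
  Nat.card {xy : (Fin 6 → ℕ) × (Fin 6 → ℕ) //
    (∀ i, 1 ≤ xy.1 i ∧ (xy.1 i : ℝ) ≤ X) ∧
    (∀ i, 1 ≤ xy.2 i ∧ (xy.2 i : ℝ) ≤ X) ∧
    (∀ j ∈ Finset.Icc 1 3, ∑ i, xy.1 i ^ j = ∑ i, xy.2 i ^ j) ∧
    (∀ i : Fin 6, if (i : ℕ) < m then (xy.1 i : ℤ) ≡ ξ [ZMOD (p : ℤ) ^ a]
      else (xy.1 i : ℤ) ≡ η [ZMOD (p : ℤ) ^ b]) ∧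
    (∀ i : Fin 6, if (i : ℕ) < m then (xy.2 i : ℤ) ≡ ξ [ZMOD (p : ℤ) ^ a]
      else (xy.2 i : ℤ) ≡ η [ZMOD (p : ℤ) ^ b])}

/-- `Imax p X m a b` : for `m = 0`, the maximum of `Icount p X 0 a b ξ η` over residues
`η mod pᵇ` (it is independent of `ξ`); for `1 ≤ m ≤ 5`, the maximum of
`Icount p X m a b ξ η` over residues `ξ mod pᵃ`, `η mod pᵇ` with `ξ ≢ η (mod p)`. -/
noncomputable def Imax (p : ℕ) (X : ℝ) (m a b : ℕ) : ℕ :=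
  if m = 0 then sSup {n : ℕ | ∃ η : ℤ, n = Icount p X 0 a b 0 η}
  else sSup {n : ℕ | ∃ ξ η : ℤ, ¬ ξ ≡ η [ZMOD (p : ℤ)] ∧ n = Icount p X m a b ξ η}

namespace VinogradovCubic

open Finset

/-- The solutions of the cubic Vinogradov system in twelve variables whose coordinates lie in
the prescribed finite sets. -/
def solutions (S T : Fin 6 → Finset ℕ) : Finset ((Fin 6 → ℕ) × (Fin 6 → ℕ)) :=
  (Fintype.piFinset S ×ˢ Fintype.piFinset T).filter fun xy =>
    ∀ j ∈ Finset.Icc 1 3, ∑ i, xy.1 i ^ j = ∑ i, xy.2 i ^ j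

/-- The positive integers up to `X` in the residue class of `ξ` modulo `p ^ a`. -/
noncomputable def progression (p : ℕ) (X : ℝ) (a : ℕ) (ξ : ℤ) : Finset ℕ :=
  (Finset.Icc 1 ⌊X⌋₊).filter fun x => (x : ℤ) ≡ ξ [ZMOD (p : ℤ) ^ a]

/-- The first `m` coordinates are restricted to `A`, the others to `B`. -/
def mixed (m : ℕ) (A B : Finset ℕ) (i : Fin 6) : Finset ℕ := if (i : ℕ) < m then A else B

/-- The mixed mean value attached to two finite sets. -/
def mixedEnergy (m : ℕ) (A B : Finset ℕ) : ℕ := #(solutions (mixed m A B) (mixed m A B))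

lemma mem_solutions {S T : Fin 6 → Finset ℕ} {xy : (Fin 6 → ℕ) × (Fin 6 → ℕ)} :
    xy ∈ solutions S T ↔ (∀ i, xy.1 i ∈ S i) ∧ (∀ i, xy.2 i ∈ T i) ∧
      ∀ j ∈ Finset.Icc 1 3, ∑ i, xy.1 i ^ j = ∑ i, xy.2 i ^ j := by
  simp [solutions, Fintype.mem_piFinset, and_assoc]

lemma mem_progression {p : ℕ} {X : ℝ} (hX : 0 ≤ X) {a : ℕ} {ξ : ℤ} {x : ℕ} :
    x ∈ progression p X a ξ ↔ (1 ≤ x ∧ (x : ℝ) ≤ X) ∧ (x : ℤ) ≡ ξ [ZMOD (p : ℤ) ^ a] := by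
  simp [progression, Nat.le_floor_iff hX]

lemma progression_subset (p : ℕ) (X : ℝ) (a : ℕ) (ξ : ℤ) :
    progression p X a ξ ⊆ Finset.Icc 1 ⌊X⌋₊ := Finset.filter_subset _ _

lemma Icount_eq_mixedEnergy (p : ℕ) {X : ℝ} (hX : 0 ≤ X) (m a b : ℕ) (ξ η : ℤ) :
    Icount p X m a b ξ η = mixedEnergy m (progression p X a ξ) (progression p X b η) := by
  have key : ∀ x : Fin 6 → ℕ,
      (∀ i, x i ∈ mixed m (progression p X a ξ) (progression p X b η) i) ↔
      (∀ i, 1 ≤ x i ∧ (x i : ℝ) ≤ X) ∧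
      ∀ i : Fin 6, if (i : ℕ) < m then (x i : ℤ) ≡ ξ [ZMOD (p : ℤ) ^ a]
        else (x i : ℤ) ≡ η [ZMOD (p : ℤ) ^ b] := by
    intro x
    rw [← forall_and]
    refine forall_congr' fun i => ?_
    unfold mixed
    split_ifs <;> rw [mem_progression hX]
  rw [Icount, mixedEnergy, Nat.subtype_card]
  rintro ⟨x, y⟩
  rw [mem_solutions]
  simp only [key]
  tauto

lemma Jcount_eq_card_solutions {X : ℝ} (hX : 0 ≤ X) :
    Jcount 6 3 X = #(solutions (fun _ => Finset.Icc 1 ⌊X⌋₊) (fun _ => Finset.Icc 1 ⌊X⌋₊)) := by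
  rw [Jcount, Nat.subtype_card]
  rintro ⟨x, y⟩
  simp only [mem_solutions, Finset.mem_Icc, Nat.le_floor_iff hX]

/-- The orthogonality relations express the number of solutions of an additive equation in a
finite abelian group through exponential sums. -/
lemma card_additive_solutions {G : Type} [AddCommGroup G] [Fintype G] [DecidableEq G]
    (φ : ℕ → G) (S T : Fin 6 → Finset ℕ) :
    (Fintype.card G : ℂ) * #((Fintype.piFinset S ×ˢ Fintype.piFinset T).filter
        fun xy => ∑ i, φ (xy.1 i) = ∑ i, φ (xy.2 i)) =
      ∑ ψ : AddChar G ℂ, (∏ i, ∑ x ∈ S i, ψ (φ x)) *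
        (starRingEnd ℂ) (∏ i, ∑ x ∈ T i, ψ (φ x)) := by
  have expand : ∀ (ψ : AddChar G ℂ) (U : Fin 6 → Finset ℕ),
      ∏ i, ∑ x ∈ U i, ψ (φ x) = ∑ x ∈ Fintype.piFinset U, ψ (∑ i, φ (x i)) := by
    intro ψ U
    rw [Finset.prod_univ_sum]
    refine Finset.sum_congr rfl fun x _ => ?_
    simp only [Fin.prod_univ_six, Fin.sum_univ_six, AddChar.map_add_eq_mul]
  have pair : ∀ ψ : AddChar G ℂ, (∏ i, ∑ x ∈ S i, ψ (φ x)) *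
        (starRingEnd ℂ) (∏ i, ∑ x ∈ T i, ψ (φ x)) =
      ∑ xy ∈ Fintype.piFinset S ×ˢ Fintype.piFinset T,
        ψ (∑ i, φ (xy.1 i) - ∑ i, φ (xy.2 i)) := by
    intro ψ
    rw [expand, expand, map_sum, Finset.sum_mul_sum, Finset.sum_product]
    refine Finset.sum_congr rfl fun x _ => Finset.sum_congr rfl fun y _ => ?_
    rw [← AddChar.map_neg_eq_conj, ← AddChar.map_add_eq_mul, sub_eq_add_neg]
  simp_rw [pair]
  rw [Finset.sum_comm]
  simp_rw [AddChar.sum_apply_eq_ite, sub_eq_zero]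
  rw [← Finset.sum_filter, Finset.sum_const, nsmul_eq_mul, mul_comm]

/-- Solutions with coordinates up to `M` are detected by a finite family of exponential sums,
whose suitably normalised absolute values are the functions `g A`. -/
lemma exists_exponential_sums (M : ℕ) :
    ∃ (ι : Type) (s : Finset ι) (g : Finset ℕ → ι → ℝ), (∀ A t, 0 ≤ g A t) ∧
      (∀ S T : Fin 6 → Finset ℕ, (∀ i, S i ⊆ Finset.Icc 1 M) → (∀ i, T i ⊆ Finset.Icc 1 M) →
        (#(solutions S T) : ℝ) ≤ ∑ t ∈ s, (∏ i, g (S i) t) * ∏ i, g (T i) t) ∧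
      (∀ S : Fin 6 → Finset ℕ, (∀ i, S i ⊆ Finset.Icc 1 M) →
        (#(solutions S S) : ℝ) = ∑ t ∈ s, (∏ i, g (S i) t) * ∏ i, g (S i) t) := by
  set N : ℕ := 6 * (M + 1) ^ 3 + 1 with hN
  have : NeZero N := ⟨by omega⟩
  let φ : ℕ → Fin 3 → ZMod N := fun x j => (x : ZMod N) ^ ((j : ℕ) + 1)
  set K : ℝ := ((Fintype.card (Fin 3 → ZMod N) : ℕ) : ℝ) with hK
  have hKpos : 0 < K := by rw [hK]; exact_mod_cast Fintype.card_pos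
  have sum_lt : ∀ x : Fin 6 → ℕ, (∀ i, x i ≤ M) → ∀ j, j ≤ 3 → ∑ i, x i ^ j < N := by
    intro x hx j hj
    have : ∑ i, x i ^ j ≤ ∑ _i : Fin 6, (M + 1) ^ 3 := Finset.sum_le_sum fun i _ =>
      (Nat.pow_le_pow_left ((hx i).trans M.le_succ) j).trans
        (Nat.pow_le_pow_right M.succ_pos hj)
    simp at this
    omega
  have sol_eq : ∀ S T : Fin 6 → Finset ℕ, (∀ i, S i ⊆ Finset.Icc 1 M) →
      (∀ i, T i ⊆ Finset.Icc 1 M) →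
      solutions S T = (Fintype.piFinset S ×ˢ Fintype.piFinset T).filter
        fun xy => ∑ i, φ (xy.1 i) = ∑ i, φ (xy.2 i) := by
    intro S T hS hT
    refine Finset.filter_congr ?_
    rintro ⟨x, y⟩ hxy
    simp only [Finset.mem_product, Fintype.mem_piFinset] at hxy
    have hx : ∀ i, x i ≤ M := fun i => (Finset.mem_Icc.1 (hS i (hxy.1 i))).2
    have hy : ∀ i, y i ≤ M := fun i => (Finset.mem_Icc.1 (hT i (hxy.2 i))).2
    have cast_iff : ∀ j, j ≤ 3 → (∑ i, (x i : ZMod N) ^ j = ∑ i, (y i : ZMod N) ^ j ↔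
        ∑ i, x i ^ j = ∑ i, y i ^ j) := by
      intro j hj
      have := ZMod.natCast_eq_natCast_iff' (∑ i, x i ^ j) (∑ i, y i ^ j) N
      rw [Nat.mod_eq_of_lt (sum_lt x hx j hj), Nat.mod_eq_of_lt (sum_lt y hy j hj)] at this
      rw [← this]
      push_cast
      rfl
    simp only [funext_iff, Finset.sum_apply, φ]
    constructor
    · intro h j
      exact (cast_iff _ (by omega)).2 (h _ (Finset.mem_Icc.2 ⟨by omega, by omega⟩))
    · intro h j hj
      rw [Finset.mem_Icc] at hj
      have := h ⟨j - 1, by omega⟩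
      simp only [Nat.sub_add_cancel hj.1] at this
      exact (cast_iff j hj.2).1 this
  let f : Finset ℕ → AddChar (Fin 3 → ZMod N) ℂ → ℂ := fun A ψ => ∑ x ∈ A, ψ (φ x)
  set c : ℝ := K⁻¹ ^ ((12 : ℝ)⁻¹) with hc
  have hc0 : 0 ≤ c := by positivity
  have hc12 : c ^ 6 * c ^ 6 = K⁻¹ := by
    rw [← pow_add, hc, ← Real.rpow_natCast, ← Real.rpow_mul (by positivity)]
    norm_num
  have scale : ∀ (S T : Fin 6 → Finset ℕ) (ψ : AddChar (Fin 3 → ZMod N) ℂ),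
      (∏ i, c * ‖f (S i) ψ‖) * ∏ i, c * ‖f (T i) ψ‖ =
        K⁻¹ * ((∏ i, ‖f (S i) ψ‖) * ∏ i, ‖f (T i) ψ‖) := by
    intro S T ψ
    rw [Finset.prod_mul_distrib, Finset.prod_mul_distrib, ← hc12]
    simp
    ring
  have identity : ∀ S T : Fin 6 → Finset ℕ, (∀ i, S i ⊆ Finset.Icc 1 M) →
      (∀ i, T i ⊆ Finset.Icc 1 M) →
      ((K * #(solutions S T) : ℝ) : ℂ) = ∑ ψ, (∏ i, f (S i) ψ) *
        (starRingEnd ℂ) (∏ i, f (T i) ψ) := by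
    intro S T hS hT
    rw [← card_additive_solutions φ S T, sol_eq S T hS hT, hK]
    push_cast
    rfl
  refine ⟨_, Finset.univ, fun A ψ => c * ‖f A ψ‖, fun A ψ => by positivity, ?_, ?_⟩
  · intro S T hS hT
    simp_rw [scale, ← Finset.mul_sum]
    rw [le_inv_mul_iff₀ hKpos]
    have := congrArg norm (identity S T hS hT)
    rw [Complex.norm_real, Real.norm_of_nonneg (by positivity)] at this
    rw [this]
    refine (norm_sum_le _ _).trans (le_of_eq ?_)
    simp
  · intro S hS
    simp_rw [scale, ← Finset.mul_sum]
    rw [eq_inv_mul_iff_mul_eq₀ hKpos.ne']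
    have := identity S S hS hS
    simp_rw [Complex.mul_conj, Complex.normSq_eq_norm_sq, norm_prod] at this
    simp_rw [← pow_two]
    exact_mod_cast this

/-- Hölder's inequality for geometric means of two functions. -/
lemma sum_rpow_mul_rpow_le {ι : Type} (s : Finset ι) (F H : ι → ℝ) (hF : ∀ t, 0 ≤ F t)
    (hH : ∀ t, 0 ≤ H t) {v w : ℝ} (hv : 0 < v) (hw : 0 < w) (hvw : v + w = 1) :
    ∑ t ∈ s, F t ^ v * H t ^ w ≤ (∑ t ∈ s, F t) ^ v * (∑ t ∈ s, H t) ^ w := by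
  have hpq : Real.HolderConjugate v⁻¹ w⁻¹ := by
    rw [Real.holderConjugate_iff]
    refine ⟨(one_lt_inv₀ hv).2 (by linarith), by simpa using hvw⟩
  have := Real.inner_le_Lp_mul_Lq_of_nonneg s hpq (f := fun t => F t ^ v)
    (g := fun t => H t ^ w) (fun t _ => Real.rpow_nonneg (hF t) _)
    (fun t _ => Real.rpow_nonneg (hH t) _)
  simpa [← Real.rpow_mul (hF _), ← Real.rpow_mul (hH _), hv.ne', hw.ne'] using this

/-- A monomial is the geometric mean of two monomials when its exponents are the corresponding
averages. -/
lemma monomial_eq_rpow_mul_rpow {x y : ℝ} (hx : 0 ≤ x) (hy : 0 ≤ y) {a b c d k l : ℕ} {v w : ℝ}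
    (hv : 0 < v) (hw : 0 < w) (hk : v * a + w * c = k) (hl : v * b + w * d = l) :
    x ^ k * y ^ l = (x ^ a * y ^ b) ^ v * (x ^ c * y ^ d) ^ w := by
  have aux : ∀ z : ℝ, 0 ≤ z → ∀ e f m : ℕ, v * e + w * f = m →
      z ^ m = (z ^ e) ^ v * (z ^ f) ^ w := by
    intro z hz e f m h
    rw [← Real.rpow_natCast z m, ← Real.rpow_natCast z e, ← Real.rpow_natCast z f,
      ← Real.rpow_mul hz, ← Real.rpow_mul hz, ← Real.rpow_add_of_nonneg hz (by positivity)
      (by positivity), ← h]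
    ring_nf
  rw [aux x hx a c k hk, aux y hy b d l hl, Real.mul_rpow (by positivity) (by positivity),
    Real.mul_rpow (by positivity) (by positivity)]
  ring

lemma mixed_subset {m M : ℕ} {A B : Finset ℕ} (hA : A ⊆ Finset.Icc 1 M)
    (hB : B ⊆ Finset.Icc 1 M) (i : Fin 6) : mixed m A B i ⊆ Finset.Icc 1 M := by
  unfold mixed
  split_ifs <;> assumption

lemma exists_moments (M : ℕ) :
    ∃ (ι : Type) (s : Finset ι) (g : Finset ℕ → ι → ℝ), (∀ A t, 0 ≤ g A t) ∧
      (∀ S T : Fin 6 → Finset ℕ, (∀ i, S i ⊆ Finset.Icc 1 M) → (∀ i, T i ⊆ Finset.Icc 1 M) →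
        (#(solutions S T) : ℝ) ≤ ∑ t ∈ s, (∏ i, g (S i) t) * ∏ i, g (T i) t) ∧
      (∀ A B, A ⊆ Finset.Icc 1 M → B ⊆ Finset.Icc 1 M →
        (mixedEnergy 0 A B : ℝ) = ∑ t ∈ s, g A t ^ 0 * g B t ^ 12 ∧
        (mixedEnergy 1 A B : ℝ) = ∑ t ∈ s, g A t ^ 2 * g B t ^ 10 ∧
        (mixedEnergy 2 A B : ℝ) = ∑ t ∈ s, g A t ^ 4 * g B t ^ 8) := by
  obtain ⟨ι, s, g, hg, hle, heq⟩ := exists_exponential_sums M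
  refine ⟨ι, s, g, hg, hle, fun A B hA hB => ⟨?_, ?_, ?_⟩⟩ <;>
  · rw [mixedEnergy, heq _ (mixed_subset hA hB)]
    refine Finset.sum_congr rfl fun t _ => ?_
    simp [Fin.prod_univ_six, mixed]
    ring

lemma mixedEnergy_two_le_swap {M : ℕ} {A B : Finset ℕ} (hA : A ⊆ Finset.Icc 1 M)
    (hB : B ⊆ Finset.Icc 1 M) :
    (mixedEnergy 2 A B : ℝ) ≤
      (mixedEnergy 2 B A : ℝ) ^ (1 / 3 : ℝ) * (mixedEnergy 1 A B : ℝ) ^ (2 / 3 : ℝ) := by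
  obtain ⟨ι, s, g, hg, -, h⟩ := exists_moments M
  rw [(h A B hA hB).2.2, (h B A hB hA).2.2, (h A B hA hB).2.1]
  refine le_trans (le_of_eq (Finset.sum_congr rfl fun t _ => ?_))
    (sum_rpow_mul_rpow_le s _ _ (fun t => mul_nonneg (pow_nonneg (hg _ t) _)
      (pow_nonneg (hg _ t) _)) (fun t => mul_nonneg (pow_nonneg (hg _ t) _)
      (pow_nonneg (hg _ t) _)) (by norm_num) (by norm_num) (by norm_num))
  rw [mul_comm (g B t ^ 4)]
  exact monomial_eq_rpow_mul_rpow (hg _ _) (hg _ _) (by norm_num) (by norm_num) (by norm_num)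
    (by norm_num)

lemma mixedEnergy_one_le_swap {M : ℕ} {A B : Finset ℕ} (hA : A ⊆ Finset.Icc 1 M)
    (hB : B ⊆ Finset.Icc 1 M) :
    (mixedEnergy 1 A B : ℝ) ≤
      (mixedEnergy 2 B A : ℝ) ^ (1 / 4 : ℝ) * (mixedEnergy 0 A B : ℝ) ^ (3 / 4 : ℝ) := by
  obtain ⟨ι, s, g, hg, -, h⟩ := exists_moments M
  rw [(h A B hA hB).2.1, (h B A hB hA).2.2, (h A B hA hB).1]
  refine le_trans (le_of_eq (Finset.sum_congr rfl fun t _ => ?_))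
    (sum_rpow_mul_rpow_le s _ _ (fun t => mul_nonneg (pow_nonneg (hg _ t) _)
      (pow_nonneg (hg _ t) _)) (fun t => mul_nonneg (pow_nonneg (hg _ t) _)
      (pow_nonneg (hg _ t) _)) (by norm_num) (by norm_num) (by norm_num))
  rw [mul_comm (g B t ^ 4)]
  exact monomial_eq_rpow_mul_rpow (hg _ _) (hg _ _) (by norm_num) (by norm_num) (by norm_num)
    (by norm_num)

lemma mixedEnergy_two_le_zero {M : ℕ} {A B : Finset ℕ} (hA : A ⊆ Finset.Icc 1 M)
    (hB : B ⊆ Finset.Icc 1 M) :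
    (mixedEnergy 2 A B : ℝ) ≤
      (mixedEnergy 0 B A : ℝ) ^ (1 / 3 : ℝ) * (mixedEnergy 0 A B : ℝ) ^ (2 / 3 : ℝ) := by
  obtain ⟨ι, s, g, hg, -, h⟩ := exists_moments M
  rw [(h A B hA hB).2.2, (h B A hB hA).1, (h A B hA hB).1]
  refine le_trans (le_of_eq (Finset.sum_congr rfl fun t _ => ?_))
    (sum_rpow_mul_rpow_le s _ _ (fun t => mul_nonneg (pow_nonneg (hg _ t) _)
      (pow_nonneg (hg _ t) _)) (fun t => mul_nonneg (pow_nonneg (hg _ t) _)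
      (pow_nonneg (hg _ t) _)) (by norm_num) (by norm_num) (by norm_num))
  rw [mul_comm (g B t ^ 0)]
  exact monomial_eq_rpow_mul_rpow (hg _ _) (hg _ _) (by norm_num) (by norm_num) (by norm_num)
    (by norm_num)

/-- The coordinate sets `A₀, A₁, B, B, B, B`. -/
def twoClasses (A₀ A₁ B : Finset ℕ) : Fin 6 → Finset ℕ := ![A₀, A₁, B, B, B, B]

/-- Off-diagonal counts are dominated by diagonal ones. -/
lemma card_solutions_twoClasses_le {M : ℕ} {A₀ A₁ A₂ A₃ B : Finset ℕ}
    (h₀ : A₀ ⊆ Finset.Icc 1 M) (h₁ : A₁ ⊆ Finset.Icc 1 M) (h₂ : A₂ ⊆ Finset.Icc 1 M)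
    (h₃ : A₃ ⊆ Finset.Icc 1 M) (hB : B ⊆ Finset.Icc 1 M) {D : ℝ}
    (b₀ : (mixedEnergy 2 A₀ B : ℝ) ≤ D) (b₁ : (mixedEnergy 2 A₁ B : ℝ) ≤ D)
    (b₂ : (mixedEnergy 2 A₂ B : ℝ) ≤ D) (b₃ : (mixedEnergy 2 A₃ B : ℝ) ≤ D) :
    (#(solutions (twoClasses A₀ A₁ B) (twoClasses A₂ A₃ B)) : ℝ) ≤ D := by
  obtain ⟨ι, s, g, hg, hle, h⟩ := exists_moments M
  rw [(h _ B h₀ hB).2.2] at b₀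
  rw [(h _ B h₁ hB).2.2] at b₁
  rw [(h _ B h₂ hB).2.2] at b₂
  rw [(h _ B h₃ hB).2.2] at b₃
  have hs : ∀ U V : Finset ℕ, U ⊆ Finset.Icc 1 M → V ⊆ Finset.Icc 1 M →
      ∀ i, twoClasses U V B i ⊆ Finset.Icc 1 M := by
    intro U V hU hV i
    fin_cases i <;> assumption
  refine (hle _ _ (hs _ _ h₀ h₁) (hs _ _ h₂ h₃)).trans ?_
  have : ∑ t ∈ s, (∏ i, g (twoClasses A₀ A₁ B i) t) * ∏ i, g (twoClasses A₂ A₃ B i) t ≤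
      ∑ t ∈ s, (g A₀ t ^ 4 * g B t ^ 8 + g A₁ t ^ 4 * g B t ^ 8 + g A₂ t ^ 4 * g B t ^ 8 +
        g A₃ t ^ 4 * g B t ^ 8) / 4 := by
    refine Finset.sum_le_sum fun t _ => ?_
    have amgm : g A₀ t * g A₁ t * (g A₂ t * g A₃ t) ≤
        (g A₀ t ^ 4 + g A₁ t ^ 4 + g A₂ t ^ 4 + g A₃ t ^ 4) / 4 := by
      nlinarith [sq_nonneg (g A₀ t * g A₁ t - g A₂ t * g A₃ t),
        sq_nonneg (g A₀ t ^ 2 - g A₁ t ^ 2), sq_nonneg (g A₂ t ^ 2 - g A₃ t ^ 2)]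
    have := mul_le_mul_of_nonneg_right amgm (pow_nonneg (hg B t) 8)
    calc _ = g A₀ t * g A₁ t * (g A₂ t * g A₃ t) * g B t ^ 8 := by
          simp [Fin.prod_univ_six, twoClasses]
          ring
      _ ≤ _ := this
      _ = _ := by ring
  refine this.trans ?_
  rw [← Finset.sum_div, Finset.sum_add_distrib, Finset.sum_add_distrib, Finset.sum_add_distrib]
  linarith

/-- The cubic Vinogradov system is translation invariant. -/
lemma power_sums_translate {x y : Fin 6 → ℤ}
    (h : ∀ j ∈ Finset.Icc 1 3, ∑ i, x i ^ j = ∑ i, y i ^ j) (s : ℤ) :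
    ∀ j ∈ Finset.Icc 1 3, ∑ i, (x i + s) ^ j = ∑ i, (y i + s) ^ j := by
  have h₁ := h 1 (by decide)
  have h₂ := h 2 (by decide)
  have h₃ := h 3 (by decide)
  intro j hj
  simp only [Fin.sum_univ_six] at *
  rw [Finset.mem_Icc] at hj
  obtain ⟨hj₁, hj₃⟩ := hj
  interval_cases j
  · linear_combination h₁
  · linear_combination h₂ + 2 * s * h₁
  · linear_combination h₃ + 3 * s * h₂ + 3 * s ^ 2 * h₁

lemma power_sums_cast {x y : Fin 6 → ℕ}
    (h : ∀ j ∈ Finset.Icc 1 3, ∑ i, x i ^ j = ∑ i, y i ^ j) :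
    ∀ j ∈ Finset.Icc 1 3, ∑ i, (x i : ℤ) ^ j = ∑ i, (y i : ℤ) ^ j := by
  intro j hj
  exact_mod_cast h j hj

/-- Solutions confined to one residue class modulo `p ^ b` are rescaled to solutions up to
`2 * X / p ^ b`. -/
lemma mixedEnergy_zero_le (A : Finset ℕ) {p : ℕ} (hp : 0 < p) {X : ℝ} {b : ℕ}
    (hX : (p : ℝ) ^ b ≤ X) (η : ℤ) :
    mixedEnergy 0 A (progression p X b η) ≤ Jcount 6 3 (2 * X / (p : ℝ) ^ b) := by
  set q : ℕ := p ^ b with hq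
  have hq0 : 0 < q := pow_pos hp b
  have hqR : (0 : ℝ) < q := by exact_mod_cast hq0
  have hqX : (q : ℝ) ≤ X := by rw [hq]; exact_mod_cast hX
  have hX0 : 0 ≤ X := hqR.le.trans hqX
  have hqp : (p : ℝ) ^ b = q := by rw [hq]; push_cast; rfl
  have hqpZ : (p : ℤ) ^ b = q := by rw [hq]; push_cast; rfl
  rw [hqp, Jcount_eq_card_solutions (by positivity), mixedEnergy]
  let θ : (Fin 6 → ℕ) → (Fin 6 → ℕ) := fun x i => x i / q + 1
  have mem_iff : ∀ x : Fin 6 → ℕ, (∀ i, x i ∈ mixed 0 A (progression p X b η) i) →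
      ∀ i, (1 ≤ x i ∧ (x i : ℝ) ≤ X) ∧ (x i : ℤ) % q = η % q := by
    intro x hx i
    have := hx i
    simp only [mixed, Nat.not_lt_zero, if_false] at this
    rw [mem_progression hX0, hqpZ] at this
    exact this
  have θ_mem : ∀ x : Fin 6 → ℕ, (∀ i, x i ∈ mixed 0 A (progression p X b η) i) →
      ∀ i, θ x i ∈ Finset.Icc 1 ⌊2 * X / (q : ℝ)⌋₊ := by
    intro x hx i
    rw [Finset.mem_Icc, Nat.le_floor_iff (by positivity), le_div_iff₀ hqR]
    refine ⟨Nat.le_add_left _ _, ?_⟩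
    have h1 : ((x i / q * q : ℕ) : ℝ) ≤ x i := by exact_mod_cast Nat.div_mul_le_self _ _
    have h2 := (mem_iff x hx i).1.2
    simp only [θ]
    push_cast at h1 ⊢
    linarith
  have θ_eq : ∀ x : Fin 6 → ℕ, (∀ i, x i ∈ mixed 0 A (progression p X b η) i) →
      ∀ i, (q : ℤ) * (θ x i : ℤ) = x i + (q - η % q) := by
    intro x hx i
    rw [← (mem_iff x hx i).2]
    have := Int.mul_ediv_add_emod (x i) q
    simp only [θ]
    push_cast
    linarith
  have θ_inj : ∀ x x' : Fin 6 → ℕ, (∀ i, x i ∈ mixed 0 A (progression p X b η) i) →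
      (∀ i, x' i ∈ mixed 0 A (progression p X b η) i) → θ x = θ x' → x = x' := by
    intro x x' hx hx' h
    funext i
    have h1 := θ_eq x hx i
    have h2 := θ_eq x' hx' i
    rw [h] at h1
    have : (x i : ℤ) = x' i := by linarith
    exact_mod_cast this
  refine Finset.card_le_card_of_injOn (fun xy => (θ xy.1, θ xy.2)) ?_ ?_
  · rintro ⟨x, y⟩ hxy
    obtain ⟨hx, hy, h⟩ := mem_solutions.1 hxy
    refine mem_solutions.2 ⟨θ_mem x hx, θ_mem y hy, fun j hj => ?_⟩
    have := power_sums_translate (power_sums_cast h) (q - η % q) j hj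
    simp_rw [← θ_eq x hx, ← θ_eq y hy, mul_pow, ← Finset.mul_sum] at this
    have := mul_left_cancel₀ (pow_ne_zero _ (by exact_mod_cast hq0.ne')) this
    exact_mod_cast this
  · rintro ⟨x, y⟩ hxy ⟨x', y'⟩ hxy' h
    obtain ⟨hx, hy, -⟩ := mem_solutions.1 hxy
    obtain ⟨hx', hy', -⟩ := mem_solutions.1 hxy'
    rw [Prod.mk.injEq] at h
    rw [θ_inj x x' hx hx' h.1, θ_inj y y' hy hy' h.2]

lemma exists_refined_class {p : ℕ} (hp : 0 < p) {x ξ : ℤ} {a : ℕ} (c : ℕ)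
    (h : x ≡ ξ [ZMOD (p : ℤ) ^ a]) :
    ∃ t ∈ Finset.range (p ^ c), ∃ k : ℤ, x = ξ + (p : ℤ) ^ a * k ∧
      k ≡ (t : ℤ) [ZMOD (p : ℤ) ^ c] ∧ x ≡ ξ + (p : ℤ) ^ a * t [ZMOD (p : ℤ) ^ (a + c)] := by
  obtain ⟨k, hk⟩ := h.symm.dvd
  have hpc : (0 : ℤ) < (p : ℤ) ^ c := by positivity
  have ht : ((k % (p : ℤ) ^ c).toNat : ℤ) = k % (p : ℤ) ^ c :=
    Int.toNat_of_nonneg (Int.emod_nonneg _ hpc.ne')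
  have hkt : k ≡ ((k % (p : ℤ) ^ c).toNat : ℤ) [ZMOD (p : ℤ) ^ c] := by
    rw [ht]
    exact (Int.mod_modEq _ _).symm
  refine ⟨(k % (p : ℤ) ^ c).toNat, ?_, k, by linarith, hkt, ?_⟩
  · rw [Finset.mem_range]
    zify
    rw [ht]
    exact Int.emod_lt_of_pos _ hpc
  · have : x = ξ + (p : ℤ) ^ a * k := by linarith
    rw [this, pow_add]
    exact (hkt.mul_left' (c := (p : ℤ) ^ a)).add_left ξ

/-- Powers of a prime `p` are coprime to integers not divisible by `p`. -/
lemma dvd_of_dvd_mul_unit {p : ℕ} (hp : p.Prime) {w z : ℤ} (hw : ¬ (p : ℤ) ∣ w) {n : ℕ}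
    (h : (p : ℤ) ^ n ∣ w * z) : (p : ℤ) ^ n ∣ z :=
  ((Nat.prime_iff_prime_int.1 hp).coprime_iff_not_dvd.2 hw).pow_left.dvd_of_dvd_mul_left h

lemma prime_not_dvd_small {p : ℕ} (h5 : 5 ≤ p) {m : ℤ} (h0 : 0 < m) (h : m < 5) :
    ¬ (p : ℤ) ∣ m := fun hd => by
  have := Int.le_of_dvd h0 hd
  omega

/-- Units in the same class modulo `p` with congruent cubes are congruent. -/
lemma pow_dvd_sub_of_pow_dvd_cube_sub {p : ℕ} (hp : p.Prime) (h5 : 5 ≤ p) {u z w : ℤ}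
    (hu : ¬ (p : ℤ) ∣ u) (hz : (p : ℤ) ∣ z - u) (hw : (p : ℤ) ∣ w - u) {n : ℕ}
    (h : (p : ℤ) ^ n ∣ z ^ 3 - w ^ 3) : (p : ℤ) ^ n ∣ z - w := by
  refine dvd_of_dvd_mul_unit hp (w := z ^ 2 + z * w + w ^ 2) (fun hd => ?_) ?_
  · have : (p : ℤ) ∣ 3 * u ^ 2 := by
      have h' : 3 * u ^ 2 = (z ^ 2 + z * w + w ^ 2) - (z - u) * (z + w + u)
          - (w - u) * (w + 2 * u) := by ring
      rw [h']
      exact ((hd.sub (hz.mul_right _)).sub (hw.mul_right _))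
    rcases (Nat.prime_iff_prime_int.1 hp).dvd_or_dvd this with h | h
    · exact prime_not_dvd_small h5 (by norm_num) (by norm_num) h
    · exact hu ((Nat.prime_iff_prime_int.1 hp).dvd_of_dvd_pow h)
  · convert h using 1
    ring

lemma dvd_of_modEq_pow {p : ℕ} {a : ℕ} (ha : 1 ≤ a) {x y : ℤ} (h : x ≡ y [ZMOD (p : ℤ) ^ a]) :
    (p : ℤ) ∣ x - y :=
  (dvd_pow_self _ (by omega)).trans h.symm.dvd

/-- The congruence modulo `p ^ (3 * b)` forced on the single variable outside the class of `η`
refines its residue class. -/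
lemma mixedEnergy_one_le {p : ℕ} (hp : p.Prime) (h5 : 5 ≤ p) {X : ℝ} (hX : 0 ≤ X) {a b : ℕ}
    (ha : 1 ≤ a) (hab : a ≤ 3 * b) {ξ η : ℤ} (hξη : ¬ ξ ≡ η [ZMOD p]) {D : ℝ}
    (hD : ∀ ξ' : ℤ, ξ' ≡ ξ [ZMOD (p : ℤ) ^ a] →
      (mixedEnergy 1 (progression p X (3 * b) ξ') (progression p X b η) : ℝ) ≤ D) :
    (mixedEnergy 1 (progression p X a ξ) (progression p X b η) : ℝ) ≤
      (p : ℝ) ^ (3 * b - a) * D := by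
  have hu : ¬ (p : ℤ) ∣ ξ - η := fun h => hξη (Int.modEq_iff_dvd.2 h).symm
  have cover : solutions (mixed 1 (progression p X a ξ) (progression p X b η))
      (mixed 1 (progression p X a ξ) (progression p X b η)) ⊆
      (Finset.range (p ^ (3 * b - a))).biUnion fun t =>
        solutions (mixed 1 (progression p X (3 * b) (ξ + (p : ℤ) ^ a * t)) (progression p X b η))
          (mixed 1 (progression p X (3 * b) (ξ + (p : ℤ) ^ a * t)) (progression p X b η)) := by
    rintro ⟨x, y⟩ hxy
    obtain ⟨hx, hy, h⟩ := mem_solutions.1 hxy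
    simp only [mixed, Fin.forall_fin_succ, Fin.forall_fin_zero] at hx hy
    simp [mem_progression hX] at hx hy
    obtain ⟨⟨hx0, hx0'⟩, hx1, hx2, hx3, hx4, hx5⟩ := hx
    obtain ⟨⟨hy0, hy0'⟩, hy1, hy2, hy3, hy4, hy5⟩ := hy
    have cubes : (p : ℤ) ^ (3 * b) ∣ ((x 0 : ℤ) - η) ^ 3 - ((y 0 : ℤ) - η) ^ 3 := by
      have h3 := power_sums_translate (power_sums_cast h) (-η) 3 (by decide)
      simp only [Fin.sum_univ_six] at h3
      have dv : ∀ v : ℕ, (v : ℤ) ≡ η [ZMOD (p : ℤ) ^ b] →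
          (p : ℤ) ^ (3 * b) ∣ ((v : ℤ) + -η) ^ 3 := by
        intro v hv
        rw [mul_comm, pow_mul]
        exact pow_dvd_pow_of_dvd hv.symm.dvd 3
      have e : ((x 0 : ℤ) - η) ^ 3 - ((y 0 : ℤ) - η) ^ 3 =
          (((y 1 : ℤ) + -η) ^ 3 + ((y 2 : ℤ) + -η) ^ 3 + ((y 3 : ℤ) + -η) ^ 3
            + ((y 4 : ℤ) + -η) ^ 3 + ((y 5 : ℤ) + -η) ^ 3) -
          (((x 1 : ℤ) + -η) ^ 3 + ((x 2 : ℤ) + -η) ^ 3 + ((x 3 : ℤ) + -η) ^ 3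
            + ((x 4 : ℤ) + -η) ^ 3 + ((x 5 : ℤ) + -η) ^ 3) := by
        linear_combination h3
      rw [e]
      exact dvd_sub
        (dvd_add (dvd_add (dvd_add (dvd_add (dv _ hy1.2) (dv _ hy2.2)) (dv _ hy3.2))
          (dv _ hy4.2)) (dv _ hy5.2))
        (dvd_add (dvd_add (dvd_add (dvd_add (dv _ hx1.2) (dv _ hx2.2)) (dv _ hx3.2))
          (dv _ hx4.2)) (dv _ hx5.2))
    have hdvd : (p : ℤ) ^ (3 * b) ∣ (x 0 : ℤ) - y 0 := by
      have := pow_dvd_sub_of_pow_dvd_cube_sub hp h5 hu (z := (x 0 : ℤ) - η) (w := (y 0 : ℤ) - η)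
        (by simpa using dvd_of_modEq_pow ha hx0') (by simpa using dvd_of_modEq_pow ha hy0') cubes
      simpa using this
    obtain ⟨t, ht, -, -, -, hxt⟩ := exists_refined_class hp.pos (3 * b - a) hx0'
    rw [Nat.add_sub_cancel' hab] at hxt
    have hyt := (Int.modEq_iff_dvd.2 hdvd).trans hxt
    refine Finset.mem_biUnion.2 ⟨t, ht, mem_solutions.2 ⟨?_, ?_, h⟩⟩ <;>
    · simp only [mixed, Fin.forall_fin_succ, Fin.forall_fin_zero]
      simp [mem_progression hX]
      tauto
  rw [mixedEnergy]
  calc _ ≤ _ := Nat.cast_le.2 ((Finset.card_le_card cover).trans Finset.card_biUnion_le)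
    _ ≤ ∑ _t ∈ Finset.range (p ^ (3 * b - a)), D := by
        rw [Nat.cast_sum]
        refine Finset.sum_le_sum fun t _ => hD _ ?_
        exact Int.modEq_iff_dvd.2 ⟨-t, by ring⟩
    _ = _ := by simp

/-- The number of zero divisor pairs modulo a prime power. -/
lemma card_mul_dvd_le {p : ℕ} (hp : p.Prime) (c : ℕ) :
    #((Finset.range (p ^ c) ×ˢ Finset.range (p ^ c)).filter fun z => p ^ c ∣ z.1 * z.2) ≤
      (c + 1) * p ^ c := by
  have count : ∀ i ≤ c, #((Finset.range (p ^ c)).filter fun z => p ^ i ∣ z) = p ^ (c - i) := by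
    intro i hi
    have : (Finset.range (p ^ c)).filter (fun z => p ^ i ∣ z) =
        (Finset.range (p ^ (c - i))).image fun z => p ^ i * z := by
      ext z
      simp only [Finset.mem_filter, Finset.mem_range, Finset.mem_image]
      have e : p ^ c = p ^ i * p ^ (c - i) := by rw [← pow_add, Nat.add_sub_cancel' hi]
      constructor
      · rintro ⟨hz, k, rfl⟩
        rw [e] at hz
        exact ⟨k, Nat.lt_of_mul_lt_mul_left hz, rfl⟩
      · rintro ⟨k, hk, rfl⟩
        rw [e]
        exact ⟨Nat.mul_lt_mul_of_pos_left hk (pow_pos hp.pos _), dvd_mul_right _ _⟩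
    rw [this, Finset.card_image_of_injective, Finset.card_range]
    exact fun k l h => Nat.eq_of_mul_eq_mul_left (pow_pos hp.pos _) h
  calc _ ≤ #((Finset.range (c + 1)).biUnion fun i =>
        ((Finset.range (p ^ c)).filter fun z => p ^ i ∣ z) ×ˢ
          ((Finset.range (p ^ c)).filter fun z => p ^ (c - i) ∣ z)) := by
        refine Finset.card_le_card fun z hz => ?_
        simp only [Finset.mem_filter, Finset.mem_product] at hz
        obtain ⟨k, l, hk, hl, hkl⟩ := Nat.dvd_mul.1 hz.2
        obtain ⟨i, hi, rfl⟩ := (Nat.dvd_prime_pow hp).1 (Dvd.intro _ hkl)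
        have : l = p ^ (c - i) := by
          refine Nat.eq_of_mul_eq_mul_left (pow_pos hp.pos i) ?_
          rw [hkl, ← pow_add, Nat.add_sub_cancel' hi]
        subst this
        simp only [Finset.mem_biUnion, Finset.mem_range, Finset.mem_product, Finset.mem_filter]
          at hz ⊢
        exact ⟨i, by omega, ⟨hz.1.1, hk⟩, hz.1.2, hl⟩
    _ ≤ ∑ i ∈ Finset.range (c + 1), p ^ c := by
        refine Finset.card_biUnion_le.trans (Finset.sum_le_sum fun i hi => ?_)
        have hi : i ≤ c := by simpa [Nat.lt_succ_iff] using hi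
        rw [Finset.card_product, count i hi, count (c - i) (Nat.sub_le _ _), ← pow_add]
        exact le_of_eq (congrArg _ (by omega))
    _ = _ := by simp

/-- A linear system whose reduction modulo `p` is nonsingular has only the trivial solution
modulo `p ^ c`. -/
lemma pow_dvd_of_perturbed_system {p : ℕ} (hp : p.Prime) (h5 : 5 ≤ p) {u : ℤ}
    (hu : ¬ (p : ℤ) ∣ u) {a c : ℕ} (ha : 1 ≤ a) {d e α β γ δ : ℤ}
    (h₁ : (p : ℤ) ^ c ∣ 2 * u * (d - e) + (p : ℤ) ^ a * (α * d + β * e))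
    (h₂ : (p : ℤ) ^ c ∣ 6 * u ^ 2 * (d + e) + (p : ℤ) ^ a * (γ * d + δ * e)) :
    (p : ℤ) ^ c ∣ d ∧ (p : ℤ) ^ c ∣ e := by
  have hpZ := Nat.prime_iff_prime_int.1 hp
  have n2 : ¬ (p : ℤ) ∣ 2 := prime_not_dvd_small h5 (by norm_num) (by norm_num)
  have n3 : ¬ (p : ℤ) ∣ 3 := prime_not_dvd_small h5 (by norm_num) (by norm_num)
  have n2u : ¬ (p : ℤ) ∣ 2 * u := hpZ.not_dvd_mul n2 hu
  have n6u : ¬ (p : ℤ) ∣ 6 * u ^ 2 := by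
    refine hpZ.not_dvd_mul ?_ fun h => hu (hpZ.dvd_of_dvd_pow h)
    exact (by norm_num : (6 : ℤ) = 2 * 3) ▸ hpZ.not_dvd_mul n2 n3
  suffices ∀ k ≤ c, (p : ℤ) ^ k ∣ d ∧ (p : ℤ) ^ k ∣ e from this c le_rfl
  intro k
  induction k with
  | zero => simp
  | succ k ih =>
    intro hk
    obtain ⟨hd, he⟩ := ih (by omega)
    have small : ∀ μ ν : ℤ, (p : ℤ) ^ (k + 1) ∣ (p : ℤ) ^ a * (μ * d + ν * e) := by
      intro μ ν
      rw [pow_succ']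
      exact mul_dvd_mul (dvd_pow_self _ (by omega))
        (dvd_add (hd.mul_left _) (he.mul_left _))
    have hdiff := dvd_of_dvd_mul_unit hp n2u
      ((dvd_add_left (small α β)).1 ((pow_dvd_pow _ hk).trans h₁))
    have hsum := dvd_of_dvd_mul_unit hp n6u
      ((dvd_add_left (small γ δ)).1 ((pow_dvd_pow _ hk).trans h₂))
    refine ⟨dvd_of_dvd_mul_unit hp n2 ?_, dvd_of_dvd_mul_unit hp n2 ?_⟩
    · rw [show 2 * d = (d + e) + (d - e) by ring]
      exact dvd_add hsum hdiff
    · rw [show 2 * e = (d + e) - (d - e) by ring]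
      exact dvd_sub hsum hdiff

/-- The linearised quadratic congruence for the refinements of a residue class. -/
def quadraticForm (u π t₁ t₂ t₃ t₄ : ℤ) : ℤ :=
  2 * u * (t₁ + t₂ - t₃ - t₄) + π * (t₁ ^ 2 + t₂ ^ 2 - t₃ ^ 2 - t₄ ^ 2)

/-- The cubic congruence for the refinements of a residue class, with the linear term
eliminated. -/
def cubicForm (u π t₁ t₂ t₃ t₄ : ℤ) : ℤ :=
  3 * u * (t₁ ^ 2 + t₂ ^ 2 - t₃ ^ 2 - t₄ ^ 2) + 2 * π * (t₁ ^ 3 + t₂ ^ 3 - t₃ ^ 3 - t₄ ^ 3)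

/-- The cofactor of `t₁ - t₃` in a combination of the quadratic and the cubic form. -/
def cofactor (u π t₁ t₂ t₃ t₄ : ℤ) : ℤ :=
  6 * u ^ 2 * ((t₁ + t₃) - (t₂ + t₄)) +
    4 * u * π * ((t₁ ^ 2 + t₁ * t₃ + t₃ ^ 2) - (t₂ ^ 2 + t₂ * t₄ + t₄ ^ 2)) +
    2 * π ^ 2 * ((t₁ ^ 2 + t₁ * t₃ + t₃ ^ 2) * (t₂ + t₄) -
      (t₂ ^ 2 + t₂ * t₄ + t₄ ^ 2) * (t₁ + t₃))

lemma sub_mul_cofactor (u π t₁ t₂ t₃ t₄ : ℤ) :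
    (t₁ - t₃) * cofactor u π t₁ t₂ t₃ t₄ =
      (2 * u + π * (t₂ + t₄)) * cubicForm u π t₁ t₂ t₃ t₄ -
      (3 * u * (t₂ + t₄) + 2 * π * (t₂ ^ 2 + t₂ * t₄ + t₄ ^ 2)) *
        quadraticForm u π t₁ t₂ t₃ t₄ := by
  unfold cofactor cubicForm quadraticForm
  ring

/-- The quadruples of refinements modulo `p ^ c` compatible with the quadratic and cubic
congruences. -/
def refinements (p a c : ℕ) (u : ℤ) : Finset (ℕ × ℕ × ℕ × ℕ) :=
  (Finset.range (p ^ c) ×ˢ Finset.range (p ^ c) ×ˢ Finset.range (p ^ c) ×ˢ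
    Finset.range (p ^ c)).filter fun t =>
      (p : ℤ) ^ c ∣ quadraticForm u ((p : ℤ) ^ a) t.1 t.2.1 t.2.2.1 t.2.2.2 ∧
      (p : ℤ) ^ c ∣ cubicForm u ((p : ℤ) ^ a) t.1 t.2.1 t.2.2.1 t.2.2.2

lemma card_refinements_le {p : ℕ} (hp : p.Prime) (h5 : 5 ≤ p) {a : ℕ} (ha : 1 ≤ a) (c : ℕ)
    {u : ℤ} (hu : ¬ (p : ℤ) ∣ u) : #(refinements p a c u) ≤ (c + 1) * p ^ (2 * c) := by
  set q : ℕ := p ^ c with hq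
  have hq0 : 0 < q := pow_pos hp.pos c
  have hqZ : (p : ℤ) ^ c = q := by rw [hq]; push_cast; rfl
  have hqZ0 : (0 : ℤ) < q := by exact_mod_cast hq0
  let res : ℤ → ℕ := fun z => (z % q).toNat
  have res_cast : ∀ z, (res z : ℤ) = z % q := fun z =>
    Int.toNat_of_nonneg (Int.emod_nonneg _ hqZ0.ne')
  have res_lt : ∀ z, res z < q := by
    intro z
    zify
    rw [res_cast]
    exact Int.emod_lt_of_pos _ hqZ0
  have res_eq : ∀ z w, res z = res w → (q : ℤ) ∣ z - w := by
    intro z w h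
    refine Int.ModEq.dvd (a := w) (b := z) ?_
    rw [Int.ModEq, ← res_cast, ← res_cast, h]
  have lt_eq : ∀ s t : ℕ, s < q → t < q → (q : ℤ) ∣ (s : ℤ) - t → s = t := by
    intro s t hs ht h
    have h2 : ((t : ℤ) : ℤ) ≡ s [ZMOD q] := Int.modEq_iff_dvd.2 h
    have h3 : t ≡ s [MOD q] := Int.natCast_modEq_iff.1 h2
    exact (Nat.ModEq.eq_of_lt_of_lt h3 ht hs).symm
  let θ : ℕ × ℕ × ℕ × ℕ → ℕ × ℕ × ℕ := fun t =>
    (t.1, res ((t.1 : ℤ) - t.2.2.1), res (cofactor u ((p : ℤ) ^ a) t.1 t.2.1 t.2.2.1 t.2.2.2))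
  have card_le : #(refinements p a c u) ≤ #(Finset.range q ×ˢ
      (Finset.range q ×ˢ Finset.range q).filter fun z => q ∣ z.1 * z.2) := by
    refine Finset.card_le_card_of_injOn θ ?_ ?_
    · rintro ⟨t₁, t₂, t₃, t₄⟩ ht
      simp only [refinements, Finset.coe_filter, Finset.mem_product, Finset.mem_range,
        Set.mem_ofPred_eq, hqZ] at ht
      simp only [θ, Finset.coe_product, Set.mem_prod, Finset.mem_coe, Finset.mem_range,
        Finset.mem_filter, Finset.mem_product]
      refine ⟨ht.1.1, ⟨res_lt _, res_lt _⟩, ?_⟩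
      zify
      rw [res_cast, res_cast, Int.dvd_iff_emod_eq_zero, ← Int.mul_emod,
        ← Int.dvd_iff_emod_eq_zero, sub_mul_cofactor]
      exact dvd_sub (ht.2.2.mul_left _) (ht.2.1.mul_left _)
    · rintro ⟨t₁, t₂, t₃, t₄⟩ ht ⟨s₁, s₂, s₃, s₄⟩ hs h
      simp only [refinements, Finset.coe_filter, Finset.mem_product, Finset.mem_range,
        Set.mem_ofPred_eq] at ht hs
      simp only [θ, Prod.mk.injEq] at h
      obtain ⟨h₁, h₃, hF⟩ := h
      subst h₁
      obtain rfl : t₃ = s₃ := by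
        refine lt_eq _ _ ht.1.2.2.1 hs.1.2.2.1 ?_
        have := (res_eq _ _ h₃).neg_right
        refine this.trans (dvd_of_eq ?_)
        ring
      have hF := res_eq _ _ hF
      rw [← hqZ] at hF
      have key := pow_dvd_of_perturbed_system hp h5 hu ha (c := c)
        (d := (t₂ : ℤ) - s₂) (e := (t₄ : ℤ) - s₄)
        (α := (t₂ : ℤ) + s₂) (β := -((t₄ : ℤ) + s₄))
        (γ := 4 * u * ((t₂ : ℤ) + s₂ + t₄) - 2 * (p : ℤ) ^ a *
          (((t₁ : ℤ) ^ 2 + t₁ * t₃ + t₃ ^ 2) - (t₁ + t₃) * ((t₂ : ℤ) + s₂ + t₄)))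
        (δ := 4 * u * ((t₄ : ℤ) + s₄ + s₂) - 2 * (p : ℤ) ^ a *
          (((t₁ : ℤ) ^ 2 + t₁ * t₃ + t₃ ^ 2) - (t₁ + t₃) * ((t₄ : ℤ) + s₄ + s₂)))
        (by
          have := dvd_sub ht.2.1 hs.2.1
          unfold quadraticForm at this
          refine this.trans (dvd_of_eq ?_)
          ring)
        (by
          have := hF.neg_right
          unfold cofactor at this
          refine this.trans (dvd_of_eq ?_)
          ring)
      rw [hqZ] at key
      rw [lt_eq _ _ ht.1.2.1 hs.1.2.1 key.1, lt_eq _ _ ht.1.2.2.2 hs.1.2.2.2 key.2]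
  refine card_le.trans ?_
  rw [Finset.card_product, Finset.card_range]
  calc q * _ ≤ q * ((c + 1) * q) := Nat.mul_le_mul_left _ (card_mul_dvd_le hp c)
    _ = _ := by rw [hq]; ring

lemma form_modEq {n : ℤ} {u π k₁ k₂ k₃ k₄ t₁ t₂ t₃ t₄ : ℤ} (h₁ : k₁ ≡ t₁ [ZMOD n])
    (h₂ : k₂ ≡ t₂ [ZMOD n]) (h₃ : k₃ ≡ t₃ [ZMOD n]) (h₄ : k₄ ≡ t₄ [ZMOD n]) :
    quadraticForm u π k₁ k₂ k₃ k₄ ≡ quadraticForm u π t₁ t₂ t₃ t₄ [ZMOD n] ∧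
    cubicForm u π k₁ k₂ k₃ k₄ ≡ cubicForm u π t₁ t₂ t₃ t₄ [ZMOD n] := by
  unfold quadraticForm cubicForm
  constructor <;> gcongr

/-- The congruences modulo `p ^ (2 * b)` forced on the variables in the class of `ξ` refine
their residue classes. -/
lemma mixedEnergy_two_le {p : ℕ} (hp : p.Prime) (h5 : 5 ≤ p) {X : ℝ} (hX : 0 ≤ X) {a b : ℕ}
    (ha : 1 ≤ a) (hab : a ≤ b) {ξ η : ℤ} (hξη : ¬ ξ ≡ η [ZMOD p]) {D : ℝ}
    (hD : ∀ ξ' : ℤ, ξ' ≡ ξ [ZMOD (p : ℤ) ^ a] →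
      (mixedEnergy 2 (progression p X (2 * b - a) ξ') (progression p X b η) : ℝ) ≤ D) :
    (mixedEnergy 2 (progression p X a ξ) (progression p X b η) : ℝ) ≤
      (2 * b + 1) * (p : ℝ) ^ (4 * (b - a)) * D := by
  have hu : ¬ (p : ℤ) ∣ ξ - η := fun h => hξη (Int.modEq_iff_dvd.2 h).symm
  obtain ⟨d, rfl⟩ := Nat.exists_eq_add_of_le hab
  have hexp : 2 * (a + d) - a = a + 2 * d := by omega
  rw [hexp] at hD
  rw [Nat.add_sub_cancel_left]
  set B := progression p X (a + d) η
  let P : ℕ → Finset ℕ := fun t => progression p X (a + 2 * d) (ξ + (p : ℤ) ^ a * t)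
  have cover : solutions (mixed 2 (progression p X a ξ) B) (mixed 2 (progression p X a ξ) B) ⊆
      (refinements p a (2 * d) (ξ - η)).biUnion fun t =>
        solutions (twoClasses (P t.1) (P t.2.1) B) (twoClasses (P t.2.2.1) (P t.2.2.2) B) := by
    rintro ⟨x, y⟩ hxy
    obtain ⟨hx, hy, h⟩ := mem_solutions.1 hxy
    simp only [mixed, Fin.forall_fin_succ, Fin.forall_fin_zero] at hx hy
    simp [mem_progression hX, B] at hx hy
    obtain ⟨⟨hx0, hx0'⟩, ⟨hx1, hx1'⟩, hx2, hx3, hx4, hx5⟩ := hx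
    obtain ⟨⟨hy0, hy0'⟩, ⟨hy1, hy1'⟩, hy2, hy3, hy4, hy5⟩ := hy
    obtain ⟨t₁, ht₁, k₁, hk₁, hkt₁, hc₁⟩ := exists_refined_class hp.pos (2 * d) hx0'
    obtain ⟨t₂, ht₂, k₂, hk₂, hkt₂, hc₂⟩ := exists_refined_class hp.pos (2 * d) hx1'
    obtain ⟨t₃, ht₃, k₃, hk₃, hkt₃, hc₃⟩ := exists_refined_class hp.pos (2 * d) hy0'
    obtain ⟨t₄, ht₄, k₄, hk₄, hkt₄, hc₄⟩ := exists_refined_class hp.pos (2 * d) hy1'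
    have dv : ∀ j, 2 ≤ j → ∀ v : ℕ, (v : ℤ) ≡ η [ZMOD (p : ℤ) ^ (a + d)] →
        (p : ℤ) ^ (2 * (a + d)) ∣ ((v : ℤ) + -η) ^ j := by
      intro j hj v hv
      rw [mul_comm, pow_mul]
      exact (pow_dvd_pow_of_dvd hv.symm.dvd 2).trans (pow_dvd_pow _ hj)
    have powers : ∀ j, 2 ≤ j → j ≤ 3 → (p : ℤ) ^ (2 * (a + d)) ∣
        ((x 0 : ℤ) + -η) ^ j + ((x 1 : ℤ) + -η) ^ j - ((y 0 : ℤ) + -η) ^ j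
          - ((y 1 : ℤ) + -η) ^ j := by
      intro j hj hj3
      have hs := power_sums_translate (power_sums_cast h) (-η) j
        (Finset.mem_Icc.2 ⟨by omega, hj3⟩)
      simp only [Fin.sum_univ_six] at hs
      have e : ((x 0 : ℤ) + -η) ^ j + ((x 1 : ℤ) + -η) ^ j - ((y 0 : ℤ) + -η) ^ j
          - ((y 1 : ℤ) + -η) ^ j =
          (((y 2 : ℤ) + -η) ^ j + ((y 3 : ℤ) + -η) ^ j
            + ((y 4 : ℤ) + -η) ^ j + ((y 5 : ℤ) + -η) ^ j) -
          (((x 2 : ℤ) + -η) ^ j + ((x 3 : ℤ) + -η) ^ j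
            + ((x 4 : ℤ) + -η) ^ j + ((x 5 : ℤ) + -η) ^ j) := by
        linear_combination hs
      rw [e]
      exact dvd_sub
        (dvd_add (dvd_add (dvd_add (dv j hj _ hy2.2) (dv j hj _ hy3.2))
          (dv j hj _ hy4.2)) (dv j hj _ hy5.2))
        (dvd_add (dvd_add (dvd_add (dv j hj _ hx2.2) (dv j hj _ hx3.2))
          (dv j hj _ hx4.2)) (dv j hj _ hx5.2))
    have sq := powers 2 le_rfl (by norm_num)
    have cu := powers 3 (by norm_num) le_rfl
    rw [hk₁, hk₂, hk₃, hk₄] at sq cu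
    have ppos : (p : ℤ) ≠ 0 := by exact_mod_cast hp.ne_zero
    have quad : (p : ℤ) ^ (2 * d) ∣ quadraticForm (ξ - η) ((p : ℤ) ^ a) k₁ k₂ k₃ k₄ := by
      refine (pow_dvd_pow (p : ℤ) (by omega : 2 * d ≤ a + 2 * d)).trans ?_
      refine (mul_dvd_mul_iff_left (pow_ne_zero a ppos)).1 ?_
      rw [← pow_add]
      refine (dvd_of_eq ?_).trans (sq.trans (dvd_of_eq ?_))
      · ring_nf
      · unfold quadraticForm
        ring
    have cubic : (p : ℤ) ^ (2 * d) ∣ cubicForm (ξ - η) ((p : ℤ) ^ a) k₁ k₂ k₃ k₄ := by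
      refine (mul_dvd_mul_iff_left (pow_ne_zero (2 * a) ppos)).1 ?_
      rw [← pow_add]
      have := dvd_sub (cu.mul_left 2) (sq.mul_left (3 * (ξ - η)))
      refine (dvd_of_eq ?_).trans (this.trans (dvd_of_eq ?_))
      · ring_nf
      · unfold cubicForm
        ring
    have forms := form_modEq (u := ξ - η) (π := (p : ℤ) ^ a) hkt₁ hkt₂ hkt₃ hkt₄
    refine Finset.mem_biUnion.2 ⟨(t₁, t₂, t₃, t₄), ?_, mem_solutions.2 ⟨?_, ?_, h⟩⟩
    · simp only [refinements, Finset.mem_filter, Finset.mem_product]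
      exact ⟨⟨ht₁, ht₂, ht₃, ht₄⟩, (forms.1.dvd_iff).1 quad,
        (forms.2.dvd_iff).1 cubic⟩
    all_goals
      simp only [twoClasses, Fin.forall_fin_succ, Fin.forall_fin_zero]
      simp [mem_progression hX, P, B]
      tauto
  have class_bound : ∀ t : ℕ, (mixedEnergy 2 (P t) B : ℝ) ≤ D := fun t =>
    hD _ (Int.modEq_iff_dvd.2 ⟨-t, by ring⟩)
  have hD0 : 0 ≤ D := le_trans (by positivity) (class_bound 0)
  have hsub : ∀ t, P t ⊆ Finset.Icc 1 ⌊X⌋₊ := fun t => progression_subset _ _ _ _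
  rw [mixedEnergy]
  calc _ ≤ _ := Nat.cast_le.2 ((Finset.card_le_card cover).trans Finset.card_biUnion_le)
    _ ≤ ∑ _t ∈ refinements p a (2 * d) (ξ - η), D := by
        rw [Nat.cast_sum]
        exact Finset.sum_le_sum fun t _ => card_solutions_twoClasses_le (hsub _) (hsub _)
          (hsub _) (hsub _) (progression_subset _ _ _ _) (class_bound _) (class_bound _)
          (class_bound _) (class_bound _)
    _ = (#(refinements p a (2 * d) (ξ - η)) : ℝ) * D := by simp
    _ ≤ (((2 * d + 1) * p ^ (2 * (2 * d)) : ℕ) : ℝ) * D := by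
        gcongr
        exact card_refinements_le hp h5 ha _ hu
    _ ≤ _ := by
        push_cast
        rw [show 2 * (2 * d) = 4 * d by ring]
        gcongr
        have : (0 : ℝ) ≤ a := by positivity
        linarith

lemma Jcount_le_rpow {X : ℝ} (hX : 0 ≤ X) : (Jcount 6 3 X : ℝ) ≤ X ^ (12 : ℝ) := by
  rw [Jcount_eq_card_solutions hX]
  calc _ ≤ (((⌊X⌋₊ ^ 6) * (⌊X⌋₊ ^ 6) : ℕ) : ℝ) := by
        refine Nat.cast_le.2 ((Finset.card_filter_le _ _).trans ?_)
        simp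
    _ = (⌊X⌋₊ : ℝ) ^ 12 := by
        push_cast
        ring
    _ ≤ X ^ 12 := by
        gcongr
        exact Nat.floor_le hX
    _ = _ := by norm_cast

lemma floor_pow_le_Jcount {X : ℝ} (hX : 0 ≤ X) : ⌊X⌋₊ ^ 6 ≤ Jcount 6 3 X := by
  rw [Jcount_eq_card_solutions hX]
  calc ⌊X⌋₊ ^ 6 = #(Fintype.piFinset fun _ : Fin 6 => Finset.Icc 1 ⌊X⌋₊) := by simp
    _ ≤ _ := Finset.card_le_card_of_injOn (fun x => (x, x))
        (fun x hx => by
          have := Fintype.mem_piFinset.1 hx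
          exact mem_solutions.2 ⟨this, this, fun _ _ => rfl⟩)
        (fun x _ y _ h => (Prod.mk.inj h).1)

lemma exponent_nonneg {δ C : ℝ}
    (h : ∀ X : ℝ, 1 ≤ X → (Jcount 6 3 X : ℝ) ≤ C * X ^ (6 + δ)) : 0 ≤ δ := by
  by_contra! hδ
  have lim := tendsto_rpow_atTop (y := -δ) (by linarith)
  obtain ⟨N, hN⟩ := Filter.eventually_atTop.1
    ((lim.comp tendsto_natCast_atTop_atTop).eventually_gt_atTop C)
  have hM := hN (N + 1) (by omega)
  simp only [Function.comp] at hM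
  set x : ℝ := ((N + 1 : ℕ) : ℝ) with hx
  have hx1 : 1 ≤ x := by
    rw [hx]
    exact_mod_cast Nat.le_add_left 1 N
  have hx0 : 0 < x := by linarith
  have hlow : x ^ (6 : ℝ) ≤ Jcount 6 3 x := by
    have := floor_pow_le_Jcount hx0.le
    rw [hx, Nat.floor_natCast] at this
    rw [hx]
    exact_mod_cast this
  have hup := hlow.trans (h x hx1)
  have hsplit : x ^ (6 : ℝ) = x ^ (-δ) * x ^ (6 + δ) := by
    rw [← Real.rpow_add hx0]
    ring_nf
  rw [hsplit] at hup
  exact absurd (le_of_mul_le_mul_right hup (Real.rpow_pos_of_pos hx0 _)) (not_le.2 hM)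

lemma sInf_exponents_nonneg :
    0 ≤ sInf {δ : ℝ | ∃ C : ℝ, ∀ X : ℝ, 1 ≤ X → (Jcount 6 3 X : ℝ) ≤ C * X ^ (6 + δ)} :=
  Real.sInf_nonneg fun _ ⟨_, h⟩ => exponent_nonneg h

lemma exists_Jcount_le {ε : ℝ} (hε : 0 < ε) :
    ∃ C : ℝ, 0 < C ∧ ∀ X : ℝ, 1 ≤ X → (Jcount 6 3 X : ℝ) ≤ C * X ^ (6 +
      sInf {δ : ℝ | ∃ C : ℝ, ∀ X : ℝ, 1 ≤ X → (Jcount 6 3 X : ℝ) ≤ C * X ^ (6 + δ)} + ε) := by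
  set s := {δ : ℝ | ∃ C : ℝ, ∀ X : ℝ, 1 ≤ X → (Jcount 6 3 X : ℝ) ≤ C * X ^ (6 + δ)}
  have hne : s.Nonempty := ⟨6, 1, fun X hX => by
    have := Jcount_le_rpow (zero_le_one.trans hX)
    norm_num at this ⊢
    exact this⟩
  obtain ⟨δ, ⟨C, hC⟩, hδ⟩ := exists_lt_of_csInf_lt hne (lt_add_of_pos_right (sInf s) hε)
  refine ⟨max C 1, by positivity, fun X hX => (hC X hX).trans ?_⟩
  exact mul_le_mul (le_max_left _ _) (Real.rpow_le_rpow_of_exponent_le hX (by linarith))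
    (by positivity) (by positivity)

lemma geom_mean_monomials {X P C C' κ e f v w : ℝ} (hX : 0 < X) (hP : 0 < P) (hC : 0 ≤ C)
    (hC' : 0 ≤ C') (hvw : v + w = 1) :
    (C * X ^ κ * P ^ e) ^ v * (C' * X ^ κ * P ^ f) ^ w =
      C ^ v * C' ^ w * X ^ κ * P ^ (e * v + f * w) := by
  have hXκ : X ^ κ = X ^ (κ * v) * X ^ (κ * w) := by
    rw [← Real.rpow_add hX, ← mul_add, hvw, mul_one]
  rw [Real.mul_rpow (by positivity) (by positivity), Real.mul_rpow (by positivity) (by positivity),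
    Real.mul_rpow (by positivity) (by positivity), Real.mul_rpow (by positivity) (by positivity),
    ← Real.rpow_mul hX.le, ← Real.rpow_mul hX.le, ← Real.rpow_mul hP.le, ← Real.rpow_mul hP.le,
    Real.rpow_add hP, hXκ]
  ring

lemma mixedEnergy_zero_le_rpow {Δ ε C₀ : ℝ} (hε : 0 < ε) (hC₀ : 0 < C₀)
    (hJ : ∀ X : ℝ, 1 ≤ X → (Jcount 6 3 X : ℝ) ≤ C₀ * X ^ (6 + Δ + ε)) (A : Finset ℕ)
    {p : ℕ} (hp : p.Prime) {X : ℝ} {b : ℕ} (hX : (p : ℝ) ^ b ≤ X) (η : ℤ) :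
    (mixedEnergy 0 A (progression p X b η) : ℝ) ≤
      C₀ * 2 ^ (6 + Δ + ε) * X ^ (6 + Δ + ε) * (p : ℝ) ^ (-(b * (6 + Δ))) := by
  have hp0 : (0 : ℝ) < p := by exact_mod_cast hp.pos
  have hp1 : (1 : ℝ) ≤ p := by exact_mod_cast hp.one_le
  have hX0 : 0 < X := (pow_pos hp0 b).trans_le hX
  have h1 : 1 ≤ 2 * X / (p : ℝ) ^ b := by
    rw [le_div_iff₀ (pow_pos hp0 b)]
    linarith
  calc (mixedEnergy 0 A (progression p X b η) : ℝ)
      ≤ Jcount 6 3 (2 * X / (p : ℝ) ^ b) := by exact_mod_cast mixedEnergy_zero_le A hp.pos hX η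
    _ ≤ C₀ * (2 * X / (p : ℝ) ^ b) ^ (6 + Δ + ε) := hJ _ h1
    _ = C₀ * 2 ^ (6 + Δ + ε) * X ^ (6 + Δ + ε) * (p : ℝ) ^ (-(b * (6 + Δ + ε))) := by
        rw [Real.div_rpow (by positivity) (by positivity), Real.mul_rpow (by norm_num) hX0.le,
          ← Real.rpow_natCast, ← Real.rpow_mul hp0.le, Real.rpow_neg hp0.le]
        ring
    _ ≤ _ := by
        have : 0 ≤ (b : ℝ) * ε := by positivity
        refine mul_le_mul_of_nonneg_left (Real.rpow_le_rpow_of_exponent_le hp1 ?_)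
          (by positivity)
        linarith

/-- One step of efficient congruencing. -/
lemma mixedEnergy_two_step {p : ℕ} (hp : p.Prime) (h5 : 5 ≤ p) {X : ℝ} (hX : 0 < X) {a b : ℕ}
    (ha : 1 ≤ a) (hab : a ≤ b) {ξ η : ℤ} (hξη : ¬ ξ ≡ η [ZMOD p]) {κ C₁ C₂ C₃ e₁ e₂ e₃ : ℝ}
    (hC₁ : 0 ≤ C₁) (hC₂ : 0 ≤ C₂) (hC₃ : 0 ≤ C₃)
    (h₁ : ∀ ξ' : ℤ, ¬ ξ' ≡ η [ZMOD p] →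
      (mixedEnergy 2 (progression p X b η) (progression p X (2 * b - a) ξ') : ℝ) ≤
        C₁ * X ^ κ * (p : ℝ) ^ e₁)
    (h₂ : ∀ ξ' : ℤ, ¬ ξ' ≡ η [ZMOD p] →
      (mixedEnergy 2 (progression p X b η) (progression p X (3 * b) ξ') : ℝ) ≤
        C₂ * X ^ κ * (p : ℝ) ^ e₂)
    (h₃ : ∀ A, (mixedEnergy 0 A (progression p X b η) : ℝ) ≤ C₃ * X ^ κ * (p : ℝ) ^ e₃) :
    (mixedEnergy 2 (progression p X a ξ) (progression p X b η) : ℝ) ≤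
      (2 * b + 1) * (C₁ ^ (1 / 3 : ℝ) * (C₂ ^ (1 / 4 : ℝ) * C₃ ^ (3 / 4 : ℝ)) ^ (2 / 3 : ℝ)) *
        X ^ κ * (p : ℝ) ^ (4 * ((b : ℝ) - a) + e₁ / 3 + 2 / 3 * (a + b) + e₂ / 6 + e₃ / 2) := by
  have hp0 : (0 : ℝ) < p := by exact_mod_cast hp.pos
  have descend : ∀ {ξ₁ ξ₂ : ℤ} {k : ℕ}, 1 ≤ k → ¬ ξ₁ ≡ η [ZMOD p] →
      ξ₂ ≡ ξ₁ [ZMOD (p : ℤ) ^ k] → ¬ ξ₂ ≡ η [ZMOD p] := by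
    intro ξ₁ ξ₂ k hk hne h h'
    exact hne ((h.symm.of_dvd (dvd_pow_self _ (by omega))).trans h')
  have sub : ∀ c ζ, progression p X c ζ ⊆ Finset.Icc 1 ⌊X⌋₊ := fun c ζ =>
    progression_subset p X c ζ
  have one_bound : ∀ ξ' : ℤ, ¬ ξ' ≡ η [ZMOD p] →
      (mixedEnergy 1 (progression p X (2 * b - a) ξ') (progression p X b η) : ℝ) ≤
        C₂ ^ (1 / 4 : ℝ) * C₃ ^ (3 / 4 : ℝ) * X ^ κ *
          (p : ℝ) ^ ((a : ℝ) + b + (e₂ * (1 / 4) + e₃ * (3 / 4))) := by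
    intro ξ' hξ'
    refine (mixedEnergy_one_le hp h5 hX.le (by omega) (by omega) hξ'
      (D := C₂ ^ (1 / 4 : ℝ) * C₃ ^ (3 / 4 : ℝ) * X ^ κ *
        (p : ℝ) ^ (e₂ * (1 / 4) + e₃ * (3 / 4))) fun ξ'' hξ'' => ?_).trans (le_of_eq ?_)
    · rw [← geom_mean_monomials hX hp0 hC₂ hC₃ (by norm_num)]
      refine (mixedEnergy_one_le_swap (sub _ _) (sub _ _)).trans ?_
      gcongr
      · exact h₂ _ (descend (by omega) hξ' hξ'')
      · exact h₃ _
    · rw [Real.rpow_add hp0 ((a : ℝ) + b), show 3 * b - (2 * b - a) = a + b by omega,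
        ← Real.rpow_natCast]
      push_cast
      ring
  refine (mixedEnergy_two_le hp h5 hX.le ha hab hξη
    (D := C₁ ^ (1 / 3 : ℝ) * (C₂ ^ (1 / 4 : ℝ) * C₃ ^ (3 / 4 : ℝ)) ^ (2 / 3 : ℝ) * X ^ κ *
      (p : ℝ) ^ (e₁ * (1 / 3) + ((a : ℝ) + b + (e₂ * (1 / 4) + e₃ * (3 / 4))) * (2 / 3)))
    fun ξ' hξ' => ?_).trans (le_of_eq ?_)
  · have hne := descend ha hξη hξ'
    rw [← geom_mean_monomials hX hp0 hC₁ (by positivity) (by norm_num)]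
    refine (mixedEnergy_two_le_swap (sub _ _) (sub _ _)).trans ?_
    gcongr
    · exact h₁ _ hne
    · exact one_bound _ hne
  · rw [show 4 * ((b : ℝ) - a) + e₁ / 3 + 2 / 3 * (a + b) + e₂ / 6 + e₃ / 2 =
        4 * ((b : ℝ) - a) +
          (e₁ * (1 / 3) + ((a : ℝ) + b + (e₂ * (1 / 4) + e₃ * (3 / 4))) * (2 / 3)) by ring,
      Real.rpow_add hp0 (4 * ((b : ℝ) - a)), ← Real.rpow_natCast]
    push_cast [Nat.cast_sub hab]
    ring

lemma mixedEnergy_two_le_rpow {Δ ε C₀ : ℝ} (hΔ : 0 ≤ Δ) (hε : 0 < ε) (hC₀ : 0 < C₀)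
    (hJ : ∀ X : ℝ, 1 ≤ X → (Jcount 6 3 X : ℝ) ≤ C₀ * X ^ (6 + Δ + ε)) (n : ℕ) :
    ∀ a b : ℕ, 1 ≤ a → a ≤ b → ∃ C : ℝ, 0 ≤ C ∧ ∀ p : ℕ, p.Prime → 5 ≤ p → ∀ X : ℝ,
      (p : ℝ) ^ (3 ^ n * b) ≤ X → ∀ ξ η : ℤ, ¬ ξ ≡ η [ZMOD p] →
        (mixedEnergy 2 (progression p X a ξ) (progression p X b η) : ℝ) ≤
          C * X ^ (6 + Δ + ε) * (p : ℝ) ^ ((-2 * (a : ℝ) - 4 * (b : ℝ)) +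
            (3 - n * Δ / 6) * (3 * (b : ℝ) - (a : ℝ))) := by
  induction n with
  | zero =>
    intro a b ha hab
    refine ⟨C₀ * 2 ^ (6 + Δ + ε), by positivity, fun p hp h5 X hX ξ η _ => ?_⟩
    have hp1 : (1 : ℝ) ≤ p := by exact_mod_cast hp.one_le
    have hp0 : (0 : ℝ) < p := by linarith
    rw [pow_zero, one_mul] at hX
    have hXa : (p : ℝ) ^ a ≤ X := (pow_le_pow_right₀ hp1 hab).trans hX
    have hX0 : 0 < X := (pow_pos hp0 b).trans_le hX
    refine (mixedEnergy_two_le_zero (progression_subset p X a ξ)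
      (progression_subset p X b η)).trans ?_
    refine (mul_le_mul
      (Real.rpow_le_rpow (by positivity) (mixedEnergy_zero_le_rpow hε hC₀ hJ _ hp hXa ξ)
        (by norm_num))
      (Real.rpow_le_rpow (by positivity) (mixedEnergy_zero_le_rpow hε hC₀ hJ _ hp hX η)
        (by norm_num)) (by positivity) (by positivity)).trans ?_
    rw [geom_mean_monomials hX0 hp0 (by positivity) (by positivity) (by norm_num),
      ← Real.rpow_add (by positivity), show (1 / 3 + 2 / 3 : ℝ) = 1 by norm_num, Real.rpow_one]
    refine mul_le_mul_of_nonneg_left (Real.rpow_le_rpow_of_exponent_le hp1 ?_) (by positivity)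
    have hab' : (a : ℝ) ≤ b := by exact_mod_cast hab
    have ha0 : (0 : ℝ) ≤ a := by positivity
    push_cast
    nlinarith [mul_nonneg ha0 hΔ, mul_nonneg (ha0.trans hab') hΔ]
  | succ n ih =>
    intro a b ha hab
    obtain ⟨C₁, hC₁, h₁⟩ := ih b (2 * b - a) (by omega) (by omega)
    obtain ⟨C₂, hC₂, h₂⟩ := ih b (3 * b) (by omega) (by omega)
    refine ⟨(2 * b + 1) * (C₁ ^ (1 / 3 : ℝ) *
      (C₂ ^ (1 / 4 : ℝ) * (C₀ * 2 ^ (6 + Δ + ε)) ^ (3 / 4 : ℝ)) ^ (2 / 3 : ℝ)),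
      by positivity, fun p hp h5 X hX ξ η hξη => ?_⟩
    have hp1 : (1 : ℝ) ≤ p := by exact_mod_cast hp.one_le
    have hp0 : (0 : ℝ) < p := by linarith
    have hX0 : 0 < X := (pow_pos hp0 _).trans_le hX
    have range_of_le : ∀ m, m ≤ 3 ^ (n + 1) * b → (p : ℝ) ^ m ≤ X := fun m hm =>
      (pow_le_pow_right₀ hp1 hm).trans hX
    have hb : b ≤ 3 ^ (n + 1) * b := Nat.le_mul_of_pos_left _ (by positivity)
    have hn : 3 ^ n * (3 * b) = 3 ^ (n + 1) * b := by ring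
    refine (mixedEnergy_two_step hp h5 hX0 ha hab hξη hC₁ hC₂
      (C₃ := C₀ * 2 ^ (6 + Δ + ε)) (by positivity)
      (fun ξ' hξ' => h₁ p hp h5 X (range_of_le _ ?_) η ξ' fun h => hξ' h.symm)
      (fun ξ' hξ' => h₂ p hp h5 X (range_of_le _ hn.le) η ξ' fun h => hξ' h.symm)
      (fun A => mixedEnergy_zero_le_rpow hε hC₀ hJ A hp (range_of_le _ hb) η)).trans ?_
    · rw [← hn]
      exact Nat.mul_le_mul_left _ (by omega)
    · refine mul_le_mul_of_nonneg_left (Real.rpow_le_rpow_of_exponent_le hp1 ?_)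
        (by positivity)
      push_cast [Nat.cast_sub (show a ≤ 2 * b by omega)]
      have : 0 ≤ (a : ℝ) * Δ := by positivity
      nlinarith

end VinogradovCubic

/-- The inductive estimate (2.4): with `Δ` the infimum of admissible exponents for
`J(X) ≪ X^(6+δ)`, for all `ε > 0`, `n ≥ 0` and `1 ≤ a ≤ b` there is `C(ε,n,a,b)` such
that `I₂(X;a,b) ≤ C · X^(6+Δ+ε) · p^(−2a−4b) · p^((3−nΔ/6)(3b−a))` whenever `p^(3ⁿb) ≤ X`. -/
theorem I2_inductive_bound
    (Δ : ℝ)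
    (hΔ : Δ = sInf {δ : ℝ | ∃ C : ℝ, ∀ X : ℝ, 1 ≤ X → (Jcount 6 3 X : ℝ) ≤ C * X ^ (6 + δ)}) :
    ∀ ε : ℝ, 0 < ε → ∀ n : ℕ, ∀ a b : ℕ, 1 ≤ a → a ≤ b →
      ∃ C : ℝ, ∀ p : ℕ, p.Prime → 5 ≤ p → ∀ X : ℝ, 1 ≤ X → (p : ℝ) ^ (3 ^ n * b) ≤ X →
        (Imax p X 2 a b : ℝ) ≤
          C * X ^ (6 + Δ + ε) * (p : ℝ) ^ (-2 * (a : ℝ) - 4 * (b : ℝ)) *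
            (p : ℝ) ^ ((3 - n * Δ / 6) * (3 * (b : ℝ) - (a : ℝ))) := by
  intro ε hε n a b ha hab
  have hΔ0 : 0 ≤ Δ := hΔ ▸ VinogradovCubic.sInf_exponents_nonneg
  obtain ⟨C₀, hC₀, hJ⟩ := VinogradovCubic.exists_Jcount_le hε
  rw [← hΔ] at hJ
  obtain ⟨C, hC, h⟩ := VinogradovCubic.mixedEnergy_two_le_rpow hΔ0 hε hC₀ hJ n a b ha hab
  refine ⟨C, fun p hp h5 X hX hpX => ?_⟩
  have hp0 : (0 : ℝ) < p := by exact_mod_cast hp.pos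
  rw [mul_assoc _ ((p : ℝ) ^ _), ← Real.rpow_add hp0, ← Nat.le_floor_iff (by positivity)]
  rw [Imax, if_neg two_ne_zero]
  refine csSup_le' ?_
  rintro m ⟨ξ, η, hξη, rfl⟩
  rw [VinogradovCubic.Icount_eq_mixedEnergy p (by linarith)]
  exact Nat.le_floor (h p hp h5 X hpX ξ η hξη)
end

section
/- Let ν be an integer with p ∤ ν, let 1 ≤ a ≤ 3b, and suppose positive integers x_1,…,x_{12} ≤ X satisfy x_1^j+⋯+x_6^j = x_7^j+⋯+x_{12}^j for j = 1,2,3, with x_1 ≡ x_7 ≡ ξ (mod p^a) and x_i ≡ η (mod p^b) for all i ∉ {1,7}, where ξ − η = ν. Then x_1 ≡ x_7 (mod p^{3b−a}). (This is the congruencing step underlying Lemma 5: the cubic equation forces the two special variables into a common residue class modulo p^{3b−a}.) -/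
/-- Two integers congruent modulo a prime `p ≥ 5`, and not divisible by it, are congruent modulo
every power of `p` modulo which their cubes are congruent. -/
theorem Int.ModEq.of_cube_modEq_prime_pow {p n : ℕ} (hp : p.Prime) (hp5 : 5 ≤ p) {u v : ℤ}
    (huv : u ≡ v [ZMOD p]) (hu : ¬ (p : ℤ) ∣ u) (h : u ^ 3 ≡ v ^ 3 [ZMOD (p : ℤ) ^ n]) :
    u ≡ v [ZMOD (p : ℤ) ^ n] := by
  have hpp : Prime (p : ℤ) := Nat.prime_iff_prime_int.mp hp
  have hcop : IsCoprime ((p : ℤ) ^ n) (v ^ 2 + v * u + u ^ 2) := by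
    refine IsCoprime.pow_left ((hpp.irreducible.coprime_iff_not_dvd).mpr fun hdvd => ?_)
    have h3 : (p : ℤ) ∣ 3 * u ^ 2 := by
      have hsub := dvd_sub hdvd (huv.dvd.mul_right (v + 2 * u))
      ring_nf at hsub ⊢
      exact hsub
    rcases hpp.dvd_or_dvd h3 with h3 | h3
    · have := Int.le_of_dvd (by norm_num) h3
      omega
    · exact hu (hpp.dvd_of_dvd_pow h3)
  refine Int.modEq_iff_dvd.mpr (hcop.dvd_of_dvd_mul_right ?_)
  have := h.dvd
  ring_nf at this ⊢
  exact this

/-- Translating a solution of the Vinogradov system of degree three preserves the cubic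
equation. -/
theorem sum_sub_cube_eq_of_sum_pow_eq {ι R : Type*} [CommRing R] (s : Finset ι) {x y : ι → R}
    (h : ∀ j ∈ Finset.Icc 1 3, ∑ i ∈ s, x i ^ j = ∑ i ∈ s, y i ^ j) (c : R) :
    ∑ i ∈ s, (x i - c) ^ 3 = ∑ i ∈ s, (y i - c) ^ 3 := by
  have h1 := h 1 (by simp)
  have h2 := h 2 (by simp)
  have h3 := h 3 (by simp)
  simp only [pow_one] at h1
  have expand (z : ι → R) : ∑ i ∈ s, (z i - c) ^ 3 = ∑ i ∈ s, z i ^ 3 - 3 * c * ∑ i ∈ s, z i ^ 2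
      + 3 * c ^ 2 * ∑ i ∈ s, z i - ∑ _i ∈ s, c ^ 3 := by
    simp only [Finset.mul_sum, ← Finset.sum_sub_distrib, ← Finset.sum_add_distrib]
    exact Finset.sum_congr rfl fun i _ => by ring
  rw [expand, expand, h1, h2, h3]

/-- The congruencing step underlying Lemma 5: if the twelve variables (encoded as two
6-tuples `x`, `y`) satisfy the Vinogradov system of degree 3, with `x₁ ≡ y₁ ≡ ξ (mod pᵃ)`
and all other variables `≡ η (mod pᵇ)`, where `ν = ξ − η` is prime to `p` and
`1 ≤ a ≤ 3b`, then `x₁ ≡ y₁ (mod p^(3b−a))`. -/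
theorem congruencing_step (p : ℕ) (hp : p.Prime) (hp5 : 5 ≤ p) (a b : ℕ) (ha : 1 ≤ a)
    (hb : 1 ≤ b) (hab : a ≤ 3 * b) (X : ℝ) (hX : 1 ≤ X) (ξ η ν : ℤ) (hν : ν = ξ - η)
    (hpν : ¬ (p : ℤ) ∣ ν) (x y : Fin 6 → ℕ)
    (hxpos : ∀ i, 1 ≤ x i) (hxle : ∀ i, (x i : ℝ) ≤ X)
    (hypos : ∀ i, 1 ≤ y i) (hyle : ∀ i, (y i : ℝ) ≤ X)
    (hsys : ∀ j ∈ Finset.Icc 1 3, ∑ i, x i ^ j = ∑ i, y i ^ j)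
    (hx0 : (x 0 : ℤ) ≡ ξ [ZMOD (p : ℤ) ^ a]) (hy0 : (y 0 : ℤ) ≡ ξ [ZMOD (p : ℤ) ^ a])
    (hxi : ∀ i : Fin 6, i ≠ 0 → (x i : ℤ) ≡ η [ZMOD (p : ℤ) ^ b])
    (hyi : ∀ i : Fin 6, i ≠ 0 → (y i : ℤ) ≡ η [ZMOD (p : ℤ) ^ b]) :
    (x 0 : ℤ) ≡ (y 0 : ℤ) [ZMOD (p : ℤ) ^ (3 * b - a)] := by
  have hsum := sum_sub_cube_eq_of_sum_pow_eq Finset.univ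
    (x := fun i => (x i : ℤ)) (y := fun i => (y i : ℤ)) (fun j hj => mod_cast hsys j hj) η
  have hcube (z : ℕ) (hz : (z : ℤ) ≡ η [ZMOD (p : ℤ) ^ b]) :
      (p : ℤ) ^ (3 * b) ∣ ((z : ℤ) - η) ^ 3 := by
    rw [mul_comm, pow_mul]
    exact pow_dvd_pow_of_dvd hz.symm.dvd 3
  have hmod : ((x 0 : ℤ) - η) ^ 3 ≡ ((y 0 : ℤ) - η) ^ 3 [ZMOD (p : ℤ) ^ (3 * b)] := by
    rw [Fin.sum_univ_succ (fun i => ((x i : ℤ) - η) ^ 3),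
      Fin.sum_univ_succ (fun i => ((y i : ℤ) - η) ^ 3)] at hsum
    have hx := Finset.dvd_sum fun (i : Fin 5) (_ : i ∈ Finset.univ) =>
      hcube (x i.succ) (hxi _ i.succ_ne_zero)
    have hy := Finset.dvd_sum fun (i : Fin 5) (_ : i ∈ Finset.univ) =>
      hcube (y i.succ) (hyi _ i.succ_ne_zero)
    rw [Int.modEq_iff_dvd]
    have heq := sub_eq_sub_iff_add_eq_add.mpr (hsum.symm.trans (add_comm _ _))
    rw [heq]
    exact dvd_sub hx hy
  have hpa : (p : ℤ) ∣ (p : ℤ) ^ a := dvd_pow_self _ (by omega)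
  have hxp := hx0.of_dvd hpa
  have hyp := hy0.of_dvd hpa
  have hnd : ¬ (p : ℤ) ∣ (x 0 : ℤ) - η := by
    rwa [(hxp.sub_right η).dvd_iff, ← hν]
  have key := Int.ModEq.of_cube_modEq_prime_pow hp hp5 ((hxp.trans hyp.symm).sub_right η) hnd hmod
  simpa using (key.add_right η).of_dvd (pow_dvd_pow (p : ℤ) (Nat.sub_le (3 * b) a))
end
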